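/- Fix λ ≥ 0, a cost vector s ≥ 0 and a classical-quantum channel (ρ_x)_{x∈X}. Let p^t be a strictly positive probability distribution and p^{t+1} its Blahut–Arimoto update. Then for every probability distribution p on X (with supp(Σ_x p_x ρ_x) ⊆ supp(Σ_x p^t_x ρ_x)): χ(p) − λ sᵀp − f_λ(p^{t+1}, p^t) ≤ Σ_x p_x log(p^{t+1}_x / p^t_x). -/

import Mathlib

open Matrix Finset Filter ComplexOrder

/-- Matrix logarithm on the support: for a Hermitian matrix, apply `Real.log`
to the eigenvalues (note `Real.log 0 = 0`, giving the logarithm on the support);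
junk value `0` otherwise. -/
noncomputable def mlog {k : ℕ} (A : Matrix (Fin k) (Fin k) ℂ) : Matrix (Fin k) (Fin k) ℂ :=
  if h : A.IsHermitian then
    (h.eigenvectorUnitary : Matrix (Fin k) (Fin k) ℂ) *
      Matrix.diagonal (fun i => (Real.log (h.eigenvalues i) : ℂ)) *
      (star (h.eigenvectorUnitary : Matrix (Fin k) (Fin k) ℂ))
  else 0

/-- A density matrix: positive semidefinite with unit trace. -/
def IsDensity {k : ℕ} (ρ : Matrix (Fin k) (Fin k) ℂ) : Prop :=
  ρ.PosSemidef ∧ ρ.trace = 1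

/-- A probability distribution on `Fin k`. -/
def IsDist {k : ℕ} (p : Fin k → ℝ) : Prop :=
  (∀ x, 0 ≤ p x) ∧ ∑ x, p x = 1

/-- `supp ρ ⊆ supp σ`, expressed as `ker σ ⊆ ker ρ`. -/
def SuppLE {k : ℕ} (ρ σ : Matrix (Fin k) (Fin k) ℂ) : Prop :=
  ∀ v, σ.mulVec v = 0 → ρ.mulVec v = 0

/-- Quantum relative entropy `D(ρ‖σ) = Tr[ρ(log ρ − log σ)]` (natural log). -/
noncomputable def qRelEnt {k : ℕ} (ρ σ : Matrix (Fin k) (Fin k) ℂ) : ℝ :=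
  (Matrix.trace (ρ * (mlog ρ - mlog σ))).re

/-- Von Neumann entropy `H(ρ) = −Tr(ρ log ρ)` (natural log). -/
noncomputable def vN {k : ℕ} (ρ : Matrix (Fin k) (Fin k) ℂ) : ℝ :=
  -(Matrix.trace (ρ * mlog ρ)).re

/-- Classical relative entropy `D(p‖q)`. -/
noncomputable def cRelEnt {k : ℕ} (p q : Fin k → ℝ) : ℝ :=
  ∑ x, p x * (Real.log (p x) - Real.log (q x))

/-- Holevo quantity `χ(p) = H(Σ_x p_x ρ_x) − Σ_x p_x H(ρ_x)`. -/
noncomputable def holevo {n m : ℕ} (ρ : Fin n → Matrix (Fin m) (Fin m) ℂ)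
    (p : Fin n → ℝ) : ℝ :=
  vN (∑ x, (p x : ℂ) • ρ x) - ∑ x, p x * vN (ρ x)

/-- `f_λ(p, p') = Σ_x Tr{p_x ρ_x [log(p'_x ρ_x) − log(p_x ρ')]} − λ sᵀp`,
where `ρ' = Σ_x p'_x ρ_x`. -/
noncomputable def fBA {n m : ℕ} (ρ : Fin n → Matrix (Fin m) (Fin m) ℂ)
    (s : Fin n → ℝ) (lam : ℝ) (p p' : Fin n → ℝ) : ℝ :=
  (∑ x, (Matrix.trace (((p x : ℂ) • ρ x) *
      (mlog ((p' x : ℂ) • ρ x) - mlog ((p x : ℂ) • ∑ y, (p' y : ℂ) • ρ y)))).re)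
    - lam * ∑ x, s x * p x

/-- `r_x = exp(Tr{ρ_x[log(p_x ρ_x) − log ρ̄]} − λ s_x)` with `ρ̄ = Σ_y p_y ρ_y`. -/
noncomputable def rBA {n m : ℕ} (ρ : Fin n → Matrix (Fin m) (Fin m) ℂ)
    (s : Fin n → ℝ) (lam : ℝ) (p : Fin n → ℝ) (x : Fin n) : ℝ :=
  Real.exp ((Matrix.trace (ρ x *
      (mlog ((p x : ℂ) • ρ x) - mlog (∑ y, (p y : ℂ) • ρ y)))).re - lam * s x)

/-- One Blahut–Arimoto update step. -/
noncomputable def baStep {n m : ℕ} (ρ : Fin n → Matrix (Fin m) (Fin m) ℂ)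
    (s : Fin n → ℝ) (lam : ℝ) (p : Fin n → ℝ) (x : Fin n) : ℝ :=
  rBA ρ s lam p x / ∑ y, rBA ρ s lam p y

/-- The Blahut–Arimoto iterates starting from `p0`. -/
noncomputable def baSeq {n m : ℕ} (ρ : Fin n → Matrix (Fin m) (Fin m) ℂ)
    (s : Fin n → ℝ) (lam : ℝ) (p0 : Fin n → ℝ) : ℕ → Fin n → ℝ
  | 0 => p0
  | t + 1 => baStep ρ s lam (baSeq ρ s lam p0 t)

theorem mlog_eq_cfc {k : ℕ} {A : Matrix (Fin k) (Fin k) ℂ} (hA : A.IsHermitian) :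
    mlog A = cfc Real.log A := by
  rw [hA.cfc_eq, IsHermitian.cfc, Unitary.conjStarAlgAut_apply, mlog, dif_pos hA]
  rfl

theorem re_trace_mul_cfc {k : ℕ} {A : Matrix (Fin k) (Fin k) ℂ} (hA : A.IsHermitian)
    (f : ℝ → ℝ) (B : Matrix (Fin k) (Fin k) ℂ) :
    (Matrix.trace (B * cfc f A)).re = ∑ j, f (hA.eigenvalues j) *
      (star ⇑(hA.eigenvectorBasis j) ⬝ᵥ B *ᵥ ⇑(hA.eigenvectorBasis j)).re := by
  rw [hA.cfc_eq, IsHermitian.cfc, Unitary.conjStarAlgAut_apply, ← mul_assoc, trace_mul_comm,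
    ← mul_assoc, ← mul_assoc, Matrix.trace, Complex.re_sum]
  refine Finset.sum_congr rfl fun j _ => ?_
  rw [diag_apply, mul_diagonal, Function.comp_apply, Function.comp_apply, mul_comm,
    mul_assoc, mul_apply]
  simp only [Complex.coe_algebraMap, Complex.re_ofReal_mul]
  rfl

theorem re_trace_eq_sum {k : ℕ} {A : Matrix (Fin k) (Fin k) ℂ} (hA : A.IsHermitian)
    (B : Matrix (Fin k) (Fin k) ℂ) :
    (Matrix.trace B).re =
      ∑ j, (star ⇑(hA.eigenvectorBasis j) ⬝ᵥ B *ᵥ ⇑(hA.eigenvectorBasis j)).re := by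
  have h := re_trace_mul_cfc hA (fun _ => 1) B
  rw [cfc_const_one ℝ A hA.isSelfAdjoint, mul_one] at h
  simpa using h

theorem re_trace_mul_mlog_smul {k : ℕ} {A B : Matrix (Fin k) (Fin k) ℂ} (hA : A.IsHermitian)
    (hBA : SuppLE B A) {c : ℝ} (hc : 0 < c) :
    (Matrix.trace (B * mlog ((c : ℂ) • A))).re =
      Real.log c * (Matrix.trace B).re + (Matrix.trace (B * mlog A)).re := by
  have hcA : (c : ℂ) • A = c • A := by ext; simp
  have hcH : (c • A).IsHermitian := hA.smul (IsSelfAdjoint.all c)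
  have hcont : ContinuousOn Real.log ((c * ·) '' spectrum ℝ A) :=
    (A.finite_real_spectrum.image _).continuousOn _
  rw [hcA, mlog_eq_cfc hcH, mlog_eq_cfc hA, ← cfc_comp_const_mul c Real.log A hcont hA.isSelfAdjoint,
    re_trace_mul_cfc hA, re_trace_mul_cfc hA, re_trace_eq_sum hA B, Finset.mul_sum,
    ← Finset.sum_add_distrib]
  refine Finset.sum_congr rfl fun j _ => ?_
  by_cases h : hA.eigenvalues j = 0
  · have h0 : B *ᵥ ⇑(hA.eigenvectorBasis j) = 0 :=
      hBA _ (by rw [hA.mulVec_eigenvectorBasis, h, zero_smul])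
    simp [h0]
  · rw [Real.log_mul hc.ne' h, add_mul]

theorem star_dotProduct_eigenvectorBasis {k : ℕ} {A : Matrix (Fin k) (Fin k) ℂ}
    (hA : A.IsHermitian) (j : Fin k) :
    star ⇑(hA.eigenvectorBasis j) ⬝ᵥ ⇑(hA.eigenvectorBasis j) = 1 := by
  rw [dotProduct_comm, ← EuclideanSpace.inner_eq_star_dotProduct,
    inner_self_eq_norm_sq_to_K, hA.eigenvectorBasis.norm_eq_one]
  simp

theorem re_dotProduct_vecMulVec {k : ℕ} (u v : Fin k → ℂ) :
    (star u ⬝ᵥ vecMulVec v (star v) *ᵥ u).re = Complex.normSq (star u ⬝ᵥ v) := by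
  have h : star v ⬝ᵥ u = star (star u ⬝ᵥ v) := star_dotProduct v u
  rw [vecMulVec_mulVec, dotProduct_smul, op_smul_eq_smul, smul_eq_mul, mul_comm, h, Complex.star_def,
    Complex.mul_conj, Complex.ofReal_re]

theorem re_dotProduct_mulVec_eq_sum {k : ℕ} {A : Matrix (Fin k) (Fin k) ℂ} (hA : A.IsHermitian)
    (v : Fin k → ℂ) :
    (star v ⬝ᵥ A *ᵥ v).re = ∑ i, hA.eigenvalues i *
      Complex.normSq (star ⇑(hA.eigenvectorBasis i) ⬝ᵥ v) := by
  have h := re_trace_mul_cfc hA id (vecMulVec v (star v))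
  rw [cfc_id ℝ A hA.isSelfAdjoint, vecMulVec_mul, trace_vecMulVec, dotProduct_comm,
    ← dotProduct_mulVec] at h
  simpa only [re_dotProduct_vecMulVec, id] using h

theorem sum_normSq_eigenvectorBasis {k : ℕ} {A : Matrix (Fin k) (Fin k) ℂ} (hA : A.IsHermitian)
    {v : Fin k → ℂ} (hv : star v ⬝ᵥ v = 1) :
    ∑ i, Complex.normSq (star ⇑(hA.eigenvectorBasis i) ⬝ᵥ v) = 1 := by
  have h := re_trace_eq_sum hA (vecMulVec v (star v))
  rw [trace_vecMulVec, dotProduct_comm, hv] at h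
  simpa only [re_dotProduct_vecMulVec, Complex.one_re] using h.symm

theorem normSq_star_dotProduct_comm {k : ℕ} (u v : Fin k → ℂ) :
    Complex.normSq (star u ⬝ᵥ v) = Complex.normSq (star v ⬝ᵥ u) := by
  rw [← Complex.normSq_conj, ← Complex.star_def, ← star_dotProduct]

theorem sub_le_mul_log_sub_log {a b : ℝ} (ha : 0 ≤ a) (hb : 0 < b) :
    a - b ≤ a * (Real.log a - Real.log b) := by
  rcases ha.eq_or_lt with rfl | ha
  · simpa using hb.le
  · have h := Real.log_le_sub_one_of_pos (div_pos hb ha)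
    rw [Real.log_div hb.ne' ha.ne'] at h
    have h2 := mul_le_mul_of_nonneg_left h ha.le
    have h3 : a * (b / a - 1) = b - a := by field_simp
    linarith

/-- Klein's inequality. -/
theorem re_trace_sub_le_qRelEnt {k : ℕ} {A B : Matrix (Fin k) (Fin k) ℂ} (hA : A.PosSemidef)
    (hB : B.PosSemidef) (hAB : SuppLE A B) :
    (Matrix.trace A).re - (Matrix.trace B).re ≤ qRelEnt A B := by
  set a := hA.isHermitian.eigenvalues with ha
  set b := hB.isHermitian.eigenvalues with hb
  let u : Fin k → Fin k → ℂ := fun i => ⇑(hA.isHermitian.eigenvectorBasis i)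
  let v : Fin k → Fin k → ℂ := fun j => ⇑(hB.isHermitian.eigenvectorBasis j)
  let w : Fin k → Fin k → ℝ := fun i j => Complex.normSq (star (u i) ⬝ᵥ v j)
  have hw : ∀ i j, 0 ≤ w i j := fun i j => Complex.normSq_nonneg _
  have hcol : ∀ j, ∑ i, w i j = 1 := fun j =>
    sum_normSq_eigenvectorBasis hA.isHermitian (star_dotProduct_eigenvectorBasis _ j)
  have hrow : ∀ i, ∑ j, w i j = 1 := fun i => by
    rw [← sum_normSq_eigenvectorBasis hB.isHermitian
      (star_dotProduct_eigenvectorBasis hA.isHermitian i)]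
    exact Finset.sum_congr rfl fun j _ => normSq_star_dotProduct_comm _ _
  have hAv : ∀ j, (star (v j) ⬝ᵥ A *ᵥ v j).re = ∑ i, a i * w i j := fun j =>
    re_dotProduct_mulVec_eq_sum hA.isHermitian _
  have htrA : (Matrix.trace A).re = ∑ i, ∑ j, w i j * a i := by
    simp_rw [← Finset.sum_mul, hrow, one_mul]
    rw [hA.isHermitian.trace_eq_sum_eigenvalues]
    simp [ha]
  have htrB : (Matrix.trace B).re = ∑ i, ∑ j, w i j * b j := by
    rw [Finset.sum_comm]
    simp_rw [← Finset.sum_mul, hcol, one_mul]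
    rw [hB.isHermitian.trace_eq_sum_eigenvalues]
    simp [hb]
  have hAA : (Matrix.trace (A * mlog A)).re = ∑ i, ∑ j, w i j * (a i * Real.log (a i)) := by
    simp_rw [← Finset.sum_mul, hrow, one_mul]
    rw [mlog_eq_cfc hA.isHermitian, re_trace_mul_cfc hA.isHermitian]
    refine Finset.sum_congr rfl fun i _ => ?_
    rw [mul_comm, ha, hA.isHermitian.eigenvalues_eq i]
    rfl
  have hABlog : (Matrix.trace (A * mlog B)).re = ∑ i, ∑ j, w i j * (a i * Real.log (b j)) := by
    rw [mlog_eq_cfc hB.isHermitian, re_trace_mul_cfc hB.isHermitian, Finset.sum_comm]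
    refine Finset.sum_congr rfl fun j _ => ?_
    refine (congrArg _ (hAv j)).trans ?_
    rw [Finset.mul_sum]
    exact Finset.sum_congr rfl fun i _ => by ring
  rw [qRelEnt, mul_sub, trace_sub, Complex.sub_re, htrA, htrB, hAA, hABlog]
  simp_rw [← Finset.sum_sub_distrib]
  refine Finset.sum_le_sum fun i _ => Finset.sum_le_sum fun j _ => ?_
  rcases (hB.eigenvalues_nonneg j).eq_or_lt with h | h
  · have h0 : A *ᵥ v j = 0 := hAB _ (by
      rw [hB.isHermitian.mulVec_eigenvectorBasis, ← h, zero_smul])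
    have hsum : ∑ i, a i * w i j = 0 := by rw [← hAv j, h0]; simp
    have hij : a i * w i j = 0 := (Finset.sum_eq_zero_iff_of_nonneg fun i _ =>
      mul_nonneg (hA.eigenvalues_nonneg i) (hw i j)).1 hsum i (Finset.mem_univ i)
    have hbj : b j = 0 := h.symm
    rw [hbj, Real.log_zero]
    linear_combination (1 - Real.log (a i)) * hij
  · have := mul_le_mul_of_nonneg_left
      (sub_le_mul_log_sub_log (hA.eigenvalues_nonneg i) h) (hw i j)
    linarith

theorem posSemidef_ofReal_smul {k : ℕ} {A : Matrix (Fin k) (Fin k) ℂ} (hA : A.PosSemidef) {c : ℝ}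
    (hc : 0 ≤ c) : ((c : ℂ) • A).PosSemidef :=
  hA.smul (by exact_mod_cast hc)

theorem suppLE_sum_smul {n k : ℕ} {ρ : Fin n → Matrix (Fin k) (Fin k) ℂ}
    (hρ : ∀ x, (ρ x).PosSemidef) {p : Fin n → ℝ} (hp : ∀ x, 0 < p x) (x : Fin n) :
    SuppLE (ρ x) (∑ y, (p y : ℂ) • ρ y) := by
  intro v hv
  rw [← (hρ x).dotProduct_mulVec_zero_iff]
  have h : ∑ y, (p y : ℂ) * (star v ⬝ᵥ ρ y *ᵥ v) = 0 := by
    have := congrArg (star v ⬝ᵥ ·) hv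
    simpa [Matrix.sum_mulVec, dotProduct_sum, smul_mulVec] using this
  have h2 := (Finset.sum_eq_zero_iff_of_nonneg fun y _ =>
    mul_nonneg (by exact_mod_cast (hp y).le) ((hρ y).dotProduct_mulVec_nonneg v)).1 h x
      (Finset.mem_univ x)
  exact (mul_eq_zero.1 h2).resolve_left (by exact_mod_cast (hp x).ne')

theorem re_trace_sum_smul_mul {n k : ℕ} (ρ : Fin n → Matrix (Fin k) (Fin k) ℂ) (p : Fin n → ℝ)
    (X : Matrix (Fin k) (Fin k) ℂ) :
    (Matrix.trace ((∑ x, (p x : ℂ) • ρ x) * X)).re = ∑ x, p x * (Matrix.trace (ρ x * X)).re := by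
  simp [Finset.sum_mul, trace_sum]

theorem re_trace_sum_smul {n k : ℕ} {ρ : Fin n → Matrix (Fin k) (Fin k) ℂ}
    (hρ : ∀ x, IsDensity (ρ x)) {p : Fin n → ℝ} (hp : IsDist p) :
    (Matrix.trace (∑ x, (p x : ℂ) • ρ x)).re = 1 := by
  simp [trace_sum, (hρ _).2, hp.2]

/-- The Holevo quantity is at most the average relative entropy to any other mixture. -/
theorem holevo_le_sum_qRelEnt {n k : ℕ} {ρ : Fin n → Matrix (Fin k) (Fin k) ℂ}
    (hρ : ∀ x, IsDensity (ρ x)) {p : Fin n → ℝ} (hp : IsDist p)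
    {σ : Matrix (Fin k) (Fin k) ℂ} (hσ : IsDensity σ) (h : SuppLE (∑ x, (p x : ℂ) • ρ x) σ) :
    holevo ρ p ≤ ∑ x, p x * qRelEnt (ρ x) σ := by
  have hτ : (∑ x, (p x : ℂ) • ρ x).PosSemidef :=
    posSemidef_sum _ fun x _ => posSemidef_ofReal_smul (hρ x).1 (hp.1 x)
  have hK := re_trace_sub_le_qRelEnt hτ hσ.1 h
  rw [re_trace_sum_smul hρ hp, hσ.2, Complex.one_re, sub_self, qRelEnt, mul_sub, trace_sub,
    Complex.sub_re, re_trace_sum_smul_mul ρ p (mlog σ)] at hK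
  simp only [holevo, vN, qRelEnt, mul_sub, trace_sub, Complex.sub_re, Finset.sum_sub_distrib,
    mul_neg, Finset.sum_neg_distrib]
  linarith

theorem log_rBA {n m : ℕ} {ρ : Fin n → Matrix (Fin m) (Fin m) ℂ} (hρ : ∀ x, IsDensity (ρ x))
    (s : Fin n → ℝ) (lam : ℝ) {p : Fin n → ℝ} (hp : ∀ x, 0 < p x) (x : Fin n) :
    Real.log (rBA ρ s lam p x) =
      Real.log (p x) + qRelEnt (ρ x) (∑ y, (p y : ℂ) • ρ y) - lam * s x := by
  rw [rBA, Real.log_exp, qRelEnt, mul_sub, mul_sub, trace_sub, trace_sub, Complex.sub_re,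
    Complex.sub_re, re_trace_mul_mlog_smul (hρ x).1.isHermitian (fun _ h => h) (hp x), (hρ x).2,
    Complex.one_re]
  ring

theorem rBA_pos {n m : ℕ} (ρ : Fin n → Matrix (Fin m) (Fin m) ℂ)
    (s : Fin n → ℝ) (lam : ℝ) (p : Fin n → ℝ) (x : Fin n) : 0 < rBA ρ s lam p x :=
  Real.exp_pos _

theorem sum_rBA_pos {n m : ℕ} [NeZero n] (ρ : Fin n → Matrix (Fin m) (Fin m) ℂ)
    (s : Fin n → ℝ) (lam : ℝ) (p : Fin n → ℝ) : 0 < ∑ y, rBA ρ s lam p y :=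
  Finset.sum_pos (fun x _ => rBA_pos ρ s lam p x) Finset.univ_nonempty

theorem baStep_pos {n m : ℕ} [NeZero n] (ρ : Fin n → Matrix (Fin m) (Fin m) ℂ)
    (s : Fin n → ℝ) (lam : ℝ) (p : Fin n → ℝ) (x : Fin n) : 0 < baStep ρ s lam p x :=
  div_pos (rBA_pos ρ s lam p x) (sum_rBA_pos ρ s lam p)

theorem log_baStep {n m : ℕ} [NeZero n] {ρ : Fin n → Matrix (Fin m) (Fin m) ℂ}
    (hρ : ∀ x, IsDensity (ρ x)) (s : Fin n → ℝ) (lam : ℝ) {p : Fin n → ℝ} (hp : ∀ x, 0 < p x)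
    (x : Fin n) :
    Real.log (baStep ρ s lam p x) =
      Real.log (p x) + qRelEnt (ρ x) (∑ y, (p y : ℂ) • ρ y) - lam * s x -
        Real.log (∑ y, rBA ρ s lam p y) := by
  rw [baStep, Real.log_div (rBA_pos ρ s lam p x).ne' (sum_rBA_pos ρ s lam p).ne', log_rBA hρ s lam hp]

/-- The value of `fBA` at a Blahut–Arimoto update is the logarithm of the normalization. -/
theorem fBA_baStep {n m : ℕ} [NeZero n] {ρ : Fin n → Matrix (Fin m) (Fin m) ℂ}
    (hρ : ∀ x, IsDensity (ρ x)) (s : Fin n → ℝ) (lam : ℝ) {p : Fin n → ℝ} (hp : ∀ x, 0 < p x) :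
    fBA ρ s lam (baStep ρ s lam p) p = Real.log (∑ y, rBA ρ s lam p y) := by
  have hZ := sum_rBA_pos ρ s lam p
  have hq1 : ∑ x, baStep ρ s lam p x = 1 := by
    simp only [baStep]
    rw [← Finset.sum_div, div_self hZ.ne']
  have hσ : (∑ x, (p x : ℂ) • ρ x).PosSemidef :=
    posSemidef_sum _ fun x _ => posSemidef_ofReal_smul (hρ x).1 (hp x).le
  rw [fBA, Finset.mul_sum, ← Finset.sum_sub_distrib]
  calc _ = ∑ x, baStep ρ s lam p x * Real.log (∑ y, rBA ρ s lam p y) := ?_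
    _ = _ := by rw [← Finset.sum_mul, hq1, one_mul]
  refine Finset.sum_congr rfl fun x _ => ?_
  rw [smul_mul_assoc, trace_smul, smul_eq_mul, Complex.re_ofReal_mul, mul_sub, trace_sub,
    Complex.sub_re, re_trace_mul_mlog_smul (hρ x).1.isHermitian (fun _ h => h) (hp x),
    re_trace_mul_mlog_smul hσ.isHermitian (suppLE_sum_smul (fun x => (hρ x).1) hp x)
      (baStep_pos ρ s lam p x),
    (hρ x).2, Complex.one_re, log_baStep hρ s lam hp x, qRelEnt, mul_sub (ρ x), trace_sub,
    Complex.sub_re]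
  ring

/-- Corollary 2: for every distribution `p` with
`supp(Σ_x p_x ρ_x) ⊆ supp(Σ_x p^t_x ρ_x)`,
`χ(p) − λsᵀp − f_λ(p^{t+1},p^t) ≤ Σ_x p_x log(p^{t+1}_x/p^t_x)`. -/
theorem stmt_7 {n m : ℕ} (lam : ℝ) (hlam : 0 ≤ lam)
    (s : Fin n → ℝ) (hs : ∀ x, 0 ≤ s x)
    (ρ : Fin n → Matrix (Fin m) (Fin m) ℂ) (hρ : ∀ x, IsDensity (ρ x))
    (pt : Fin n → ℝ) (hpt : IsDist pt) (hptpos : ∀ x, 0 < pt x)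
    (p : Fin n → ℝ) (hp : IsDist p)
    (hsupp : SuppLE (∑ x, (p x : ℂ) • ρ x) (∑ x, (pt x : ℂ) • ρ x)) :
    holevo ρ p - lam * (∑ x, s x * p x) - fBA ρ s lam (baStep ρ s lam pt) pt ≤
      ∑ x, p x * Real.log (baStep ρ s lam pt x / pt x) := by
  obtain _ | n := n
  · simpa using hp.2
  have hσ : IsDensity (∑ x, (pt x : ℂ) • ρ x) :=
    ⟨posSemidef_sum _ fun x _ => posSemidef_ofReal_smul (hρ x).1 (hptpos x).le, by
      simp only [trace_sum, trace_smul, (hρ _).2, smul_eq_mul, mul_one]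
      exact_mod_cast hpt.2⟩
  have hχ := holevo_le_sum_qRelEnt hρ hp hσ hsupp
  have hsum : ∑ x, p x * Real.log (baStep ρ s lam pt x / pt x) =
      ∑ x, p x * qRelEnt (ρ x) (∑ y, (pt y : ℂ) • ρ y) - lam * ∑ x, s x * p x -
        (∑ x, p x) * Real.log (∑ y, rBA ρ s lam pt y) := by
    rw [Finset.mul_sum, Finset.sum_mul, ← Finset.sum_sub_distrib, ← Finset.sum_sub_distrib]
    refine Finset.sum_congr rfl fun x _ => ?_
    rw [Real.log_div (baStep_pos ρ s lam pt x).ne' (hptpos x).ne',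
      log_baStep hρ s lam hptpos]
    ring
  rw [fBA_baStep hρ s lam hptpos, hsum, hp.2]
  linarith
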